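/- Let Y = θ₀ + Z with Z ~ N(0, σ²Iₙ), σ > 0, and let {H_s}_{s∈S} be a finite collection of orthogonal projection matrices. Let ŝ(Y) be a measurable minimizer of SURE(s) = ‖Y − H_sY‖₂² + 2σ² tr(H_s), and Risk(θ̂_{ŝ}) = E[‖H_{ŝ(Y)}Y − θ₀‖₂²]. There is a universal constant C such that if min_{s∈S} R(s) ≥ σ² log|S| and min_{s∈S} R(s) ≥ σ² (where R(s) = ‖(I − H_s)θ₀‖₂² + σ² tr(H_s)), then for all η > 0, Risk(θ̂_{ŝ}) ≤ (1 + Cη) min_{s∈S} R(s) + C σ² log|S| / η. -/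

import Mathlib

open MeasureTheory ProbabilityTheory Matrix Real

/-- The Gaussian measure `N(0, σ²Iₙ)` on `ℝⁿ` (the law of the noise `Z`). -/
noncomputable def gaussianVec (n : ℕ) (σ : ℝ) : Measure (Fin n → ℝ) :=
  Measure.pi fun _ : Fin n => gaussianReal 0 (σ ^ 2).toNNReal

/-- `SURE(s, y) = ‖y − H_s y‖² + 2σ² tr(H_s)`. -/
noncomputable def SUREf {n : ℕ} {S : Type} (σ : ℝ)
    (H : S → Matrix (Fin n) (Fin n) ℝ) (s : S) (y : Fin n → ℝ) : ℝ :=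
  (∑ i, (y i - (H s).mulVec y i) ^ 2) + 2 * σ ^ 2 * (H s).trace

/-- For projection estimators, `R(s) = ‖(I − H_s)θ₀‖² + σ² tr(H_s)`. -/
noncomputable def riskP {n : ℕ} {S : Type} (σ : ℝ) (θ₀ : Fin n → ℝ)
    (H : S → Matrix (Fin n) (Fin n) ℝ) (s : S) : ℝ :=
  (∑ i, (θ₀ i - (H s).mulVec θ₀ i) ^ 2) + σ ^ 2 * (H s).trace

/-- The law `N(0, σ²Iₙ)` is obtained from standard Gaussian coordinates in any orthonormal basis. -/
lemma gaussianVec_eq_map_orthonormalBasis {n : ℕ} (σ : ℝ)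
    (b : OrthonormalBasis (Fin n) ℝ (EuclideanSpace ℝ (Fin n))) :
    gaussianVec n σ = (Measure.pi fun _ : Fin n => gaussianReal 0 1).map
      (fun x => WithLp.ofLp (σ • ∑ i, x i • b i)) := by
  have hstd := (map_pi_eq_stdGaussian (ι := Fin n)).trans
    (stdGaussian_eq_map_pi_orthonormalBasis b)
  have hscale : gaussianVec n σ =
      (Measure.pi fun _ : Fin n => gaussianReal 0 1).map (fun x i => σ * x i) := by
    rw [gaussianVec, Measure.pi_map_pi (f := fun _ x => σ * x)
      (fun _ => (measurable_const_mul σ).aemeasurable)]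
    congr 1
    ext1 i
    rw [gaussianReal_map_const_mul]
    congr 1
    · simp
    · ext; simp [sq_nonneg]
  have hcomp : (fun x : Fin n → ℝ => WithLp.ofLp (σ • ∑ i, x i • b i)) =
      (fun v : EuclideanSpace ℝ (Fin n) => WithLp.ofLp (σ • v)) ∘ fun x => ∑ i, x i • b i := rfl
  rw [hcomp, ← Measure.map_map (by fun_prop) (by fun_prop), ← hstd,
    Measure.map_map (by fun_prop) (by fun_prop), hscale]
  rfl

/-- For an orthogonal projector `A`, the squared norm `‖AZ‖²` is distributed as `σ²` times a sum of
`tr A` squared independent standard Gaussians. -/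
lemma exists_map_sum_sq_mulVec_gaussianVec {n : ℕ} (σ : ℝ) {A : Matrix (Fin n) (Fin n) ℝ}
    (hA : A * A = A) (hsymm : A.IsSymm) :
    ∃ d : Fin n → ℝ, (∀ j, d j = 0 ∨ d j = 1) ∧ ∑ j, d j = A.trace ∧
      (gaussianVec n σ).map (fun z => ∑ i, (A.mulVec z i) ^ 2) =
        (Measure.pi fun _ : Fin n => gaussianReal 0 1).map
          (fun x => σ ^ 2 * ∑ j, d j * x j ^ 2) := by
  have hH : A.IsHermitian := by
    rw [Matrix.IsHermitian, Matrix.conjTranspose_eq_transpose_of_trivial]; exact hsymm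
  have hev : ∀ j, hH.eigenvalues j = 0 ∨ hH.eigenvalues j = 1 := by
    intro j
    have h1 := hH.mulVec_eigenvectorBasis j
    have h2 : A.mulVec (A.mulVec (hH.eigenvectorBasis j)) = A.mulVec (hH.eigenvectorBasis j) := by
      rw [Matrix.mulVec_mulVec, hA]
    rw [h1, Matrix.mulVec_smul, h1, smul_smul] at h2
    have hne : (WithLp.ofLp (hH.eigenvectorBasis j)) ≠ 0 := by
      intro h
      have := hH.eigenvectorBasis.orthonormal.ne_zero j
      exact this (by ext i; exact congrFun h i)
    have h3 := smul_left_injective ℝ hne h2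
    have h4 : hH.eigenvalues j * (hH.eigenvalues j - 1) = 0 := by linear_combination h3
    rcases mul_eq_zero.1 h4 with h | h
    · exact Or.inl h
    · exact Or.inr (by linarith)
  refine ⟨hH.eigenvalues, hev, ?_, ?_⟩
  · rw [hH.trace_eq_sum_eigenvalues]; simp
  · rw [gaussianVec_eq_map_orthonormalBasis σ hH.eigenvectorBasis,
      Measure.map_map (by fun_prop) (by fun_prop)]
    congr 1
    ext x
    simp only [Function.comp_apply]
    have hmul : A.mulVec (WithLp.ofLp (σ • ∑ i, x i • hH.eigenvectorBasis i)) =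
        WithLp.ofLp (∑ i, (σ * (hH.eigenvalues i * x i)) • hH.eigenvectorBasis i) := by
      simp only [WithLp.ofLp_smul, WithLp.ofLp_sum, Matrix.mulVec_smul, Matrix.mulVec_sum,
        hH.mulVec_eigenvectorBasis, Finset.smul_sum, smul_smul]
      refine Finset.sum_congr rfl fun i _ => ?_
      congr 1; ring
    rw [hmul, ← EuclideanSpace.real_norm_sq_eq, ← real_inner_self_eq_norm_sq,
      hH.eigenvectorBasis.orthonormal.inner_sum, Finset.mul_sum]
    refine Finset.sum_congr rfl fun j _ => ?_
    rcases hev j with h | h <;> (simp [h]; try ring)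

/-- Exponential moments of the square of a standard Gaussian. -/
lemma integrable_exp_mul_sq_gaussianReal {t : ℝ} (ht : t < 1 / 2) :
    Integrable (fun x => Real.exp (t * x ^ 2)) (gaussianReal 0 1) := by
  rw [gaussianReal_of_var_ne_zero _ one_ne_zero]
  rw [integrable_withDensity_iff_integrable_smul' (measurable_gaussianPDF 0 1)
    (by simp [gaussianPDF])]
  have := (integrable_exp_neg_mul_sq (b := 1 / 2 - t) (by linarith)).const_mul (√(2 * π))⁻¹
  refine this.congr (Filter.Eventually.of_forall fun x => ?_)
  simp only [toReal_gaussianPDF, gaussianPDFReal, smul_eq_mul, NNReal.coe_one, mul_one, mul_assoc,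
    ← Real.exp_add]
  congr 2
  ring

lemma integral_exp_mul_sq_gaussianReal (t : ℝ) :
    ∫ x, Real.exp (t * x ^ 2) ∂(gaussianReal 0 1) = (√(1 - 2 * t))⁻¹ := by
  rw [integral_gaussianReal_eq_integral_smul one_ne_zero]
  have h : ∀ x : ℝ, gaussianPDFReal 0 1 x • Real.exp (t * x ^ 2) =
      (√(2 * π))⁻¹ * Real.exp (-(1 / 2 - t) * x ^ 2) := by
    intro x
    simp only [gaussianPDFReal, smul_eq_mul, NNReal.coe_one, mul_one, mul_assoc, ← Real.exp_add]
    congr 2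
    ring
  simp_rw [h]
  rw [integral_const_mul, integral_gaussian, ← Real.sqrt_inv, ← Real.sqrt_inv,
    ← Real.sqrt_mul (by positivity)]
  congr 1
  rw [show (1 : ℝ) - 2 * t = 2 * (1 / 2 - t) by ring, mul_inv, mul_inv, div_eq_mul_inv]
  field_simp

lemma integral_exp_mul_sq_gaussianReal_le {t : ℝ} (ht : t ≤ 1 / 4) :
    ∫ x, Real.exp (t * x ^ 2) ∂(gaussianReal 0 1) ≤ Real.exp (t + 4 * t ^ 2) := by
  rw [integral_exp_mul_sq_gaussianReal]
  have hpos : 0 < 1 - 2 * t := by linarith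
  have hlog := Real.one_sub_inv_le_log_of_pos hpos
  have hinv : (1 - 2 * t)⁻¹ ≤ 1 + 2 * t + 8 * t ^ 2 := by
    rw [inv_le_iff_one_le_mul₀ hpos]
    nlinarith [mul_nonneg (sq_nonneg t) (by linarith : 0 ≤ 1 - 4 * t)]
  rw [← Real.exp_log (inv_pos.2 (Real.sqrt_pos.2 hpos)), Real.log_inv, Real.log_sqrt hpos.le]
  exact Real.exp_le_exp.2 (by linarith)

lemma integrable_exp_mul_indicator_sq_gaussianReal {t c : ℝ} (ht : t ≤ 1 / 4)
    (hc : c = 0 ∨ c = 1) :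
    Integrable (fun x => Real.exp (t * (c * x ^ 2))) (gaussianReal 0 1) := by
  rcases hc with rfl | rfl
  · simp
  · simpa using integrable_exp_mul_sq_gaussianReal (by linarith : t < 1 / 2)

lemma integral_exp_mul_indicator_sq_gaussianReal_le {t c : ℝ} (ht : t ≤ 1 / 4)
    (hc : c = 0 ∨ c = 1) :
    ∫ x, Real.exp (t * (c * x ^ 2)) ∂(gaussianReal 0 1) ≤ Real.exp (c * (t + 4 * t ^ 2)) := by
  rcases hc with rfl | rfl
  · simp
  · simpa using integral_exp_mul_sq_gaussianReal_le ht

/-- Exponential moment of `‖AZ‖² / σ²` for an orthogonal projector `A`. -/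
lemma exp_sum_sq_mulVec_gaussianVec {n : ℕ} {σ : ℝ} (hσ : 0 < σ) {A : Matrix (Fin n) (Fin n) ℝ}
    (hA : A * A = A) (hsymm : A.IsSymm) {t : ℝ} (ht : t ≤ 1 / 4) :
    Integrable (fun z => Real.exp (t / σ ^ 2 * ∑ i, (A.mulVec z i) ^ 2)) (gaussianVec n σ) ∧
    ∫ z, Real.exp (t / σ ^ 2 * ∑ i, (A.mulVec z i) ^ 2) ∂(gaussianVec n σ) ≤
      Real.exp (A.trace * (t + 4 * t ^ 2)) := by
  obtain ⟨d, hd, htr, hmap⟩ := exists_map_sum_sq_mulVec_gaussianVec σ hA hsymm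
  have hm : AEMeasurable (fun z : Fin n → ℝ => ∑ i, (A.mulVec z i) ^ 2) (gaussianVec n σ) := by
    fun_prop
  have hm' : AEMeasurable (fun x : Fin n → ℝ => σ ^ 2 * ∑ j, d j * x j ^ 2)
      (Measure.pi fun _ : Fin n => gaussianReal 0 1) :=
    (by fun_prop : Measurable fun x : Fin n → ℝ => σ ^ 2 * ∑ j, d j * x j ^ 2).aemeasurable
  have hprod : ∀ x : Fin n → ℝ, Real.exp (t / σ ^ 2 * (σ ^ 2 * ∑ j, d j * x j ^ 2)) =
      ∏ j, Real.exp (t * (d j * x j ^ 2)) := by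
    intro x
    rw [← Real.exp_sum, ← Finset.mul_sum]
    congr 1
    field_simp
  have hf : ∀ μ : Measure ℝ, AEStronglyMeasurable (fun w : ℝ => Real.exp (t / σ ^ 2 * w)) μ :=
    fun μ => (by fun_prop : Continuous fun w : ℝ => Real.exp (t / σ ^ 2 * w)).aestronglyMeasurable
  constructor
  · have h : Integrable (fun w : ℝ => Real.exp (t / σ ^ 2 * w))
        ((Measure.pi fun _ : Fin n => gaussianReal 0 1).map
          (fun x => σ ^ 2 * ∑ j, d j * x j ^ 2)) := by
      rw [integrable_map_measure (hf _) hm']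
      simp only [Function.comp_def, hprod]
      exact Integrable.fintype_prod (f := fun j x => Real.exp (t * (d j * x ^ 2)))
        fun j => integrable_exp_mul_indicator_sq_gaussianReal ht (hd j)
    rw [← hmap, integrable_map_measure (hf _) hm] at h
    exact h
  · rw [← integral_map hm (hf _), hmap, integral_map hm' (hf _)]
    simp only [hprod]
    rw [integral_fintype_prod_eq_prod (f := fun j x => Real.exp (t * (d j * x ^ 2))), ← htr,
      Finset.sum_mul, Real.exp_sum]
    exact Finset.prod_le_prod (fun j _ => integral_nonneg fun x => (Real.exp_pos _).le)
      fun j _ => integral_exp_mul_indicator_sq_gaussianReal_le ht (hd j)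

lemma integral_sq_gaussianReal : ∫ x, x ^ 2 ∂(gaussianReal 0 1) = 1 := by
  have h := variance_id_gaussianReal (μ := 0) (v := 1)
  rw [variance_of_integral_eq_zero aemeasurable_id (by simp)] at h
  simpa using h

lemma integrable_sq_gaussianReal : Integrable (fun x => x ^ 2) (gaussianReal 0 1) :=
  (memLp_id_gaussianReal 2).integrable_sq

/-- `E‖AZ‖² = σ² tr A` for an orthogonal projector `A`. -/
lemma sum_sq_mulVec_gaussianVec {n : ℕ} (σ : ℝ) {A : Matrix (Fin n) (Fin n) ℝ}
    (hA : A * A = A) (hsymm : A.IsSymm) :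
    Integrable (fun z => ∑ i, (A.mulVec z i) ^ 2) (gaussianVec n σ) ∧
    ∫ z, ∑ i, (A.mulVec z i) ^ 2 ∂(gaussianVec n σ) = σ ^ 2 * A.trace := by
  obtain ⟨d, hd, htr, hmap⟩ := exists_map_sum_sq_mulVec_gaussianVec σ hA hsymm
  have hm : AEMeasurable (fun z : Fin n → ℝ => ∑ i, (A.mulVec z i) ^ 2) (gaussianVec n σ) := by
    fun_prop
  have hm' : AEMeasurable (fun x : Fin n → ℝ => σ ^ 2 * ∑ j, d j * x j ^ 2)
      (Measure.pi fun _ : Fin n => gaussianReal 0 1) :=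
    (by fun_prop : Measurable fun x : Fin n → ℝ => σ ^ 2 * ∑ j, d j * x j ^ 2).aemeasurable
  have hInt : ∀ j, Integrable (fun x : Fin n → ℝ => d j * x j ^ 2)
      (Measure.pi fun _ : Fin n => gaussianReal 0 1) := fun j =>
    (integrable_comp_eval (μ := fun _ : Fin n => gaussianReal 0 1) (i := j)
      (f := fun x : ℝ => x ^ 2) integrable_sq_gaussianReal).const_mul (d j)
  constructor
  · have h : Integrable id ((Measure.pi fun _ : Fin n => gaussianReal 0 1).map
          (fun x => σ ^ 2 * ∑ j, d j * x j ^ 2)) := by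
      rw [integrable_map_measure aestronglyMeasurable_id hm']
      exact (integrable_finsetSum _ fun j _ => hInt j).const_mul (σ ^ 2)
    rw [← hmap, integrable_map_measure aestronglyMeasurable_id hm] at h
    exact h
  · have h1 := integral_map hm (aestronglyMeasurable_id (α := ℝ))
    have h2 := integral_map hm' (aestronglyMeasurable_id (α := ℝ))
    rw [hmap] at h1
    simp only [id] at h1 h2
    rw [← h1, h2, integral_const_mul, integral_finsetSum _ fun j _ => hInt j, ← htr]
    congr 1
    refine Finset.sum_congr rfl fun j _ => ?_
    rw [integral_const_mul, integral_comp_eval (μ := fun _ : Fin n => gaussianReal 0 1)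
      (i := j) (f := fun x : ℝ => x ^ 2) (by fun_prop), integral_sq_gaussianReal, mul_one]

/-- The moment generating function of `N(0, σ²Iₙ)`. -/
lemma exp_dotProduct_gaussianVec {n : ℕ} (σ : ℝ) (a : Fin n → ℝ) :
    Integrable (fun z => Real.exp (∑ i, a i * z i)) (gaussianVec n σ) ∧
    ∫ z, Real.exp (∑ i, a i * z i) ∂(gaussianVec n σ) =
      Real.exp (σ ^ 2 * (∑ i, a i ^ 2) / 2) := by
  simp_rw [Real.exp_sum]
  constructor
  · exact Integrable.fintype_prod (f := fun i x => Real.exp (a i * x))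
      fun i => integrable_exp_mul_gaussianReal (a i)
  · rw [gaussianVec, integral_fintype_prod_eq_prod (f := fun i x => Real.exp (a i * x)),
      Finset.mul_sum, Finset.sum_div, Real.exp_sum]
    refine Finset.prod_congr rfl fun i _ => ?_
    have h := congrFun (mgf_id_gaussianReal (μ := 0) (v := (σ ^ 2).toNNReal)) (a i)
    simp only [mgf, id] at h
    rw [h, Real.coe_toNNReal _ (sq_nonneg σ)]
    congr 1; ring

lemma dotProduct_gaussianVec {n : ℕ} (σ : ℝ) (a : Fin n → ℝ) :
    Integrable (fun z => ∑ i, a i * z i) (gaussianVec n σ) ∧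
    ∫ z, ∑ i, a i * z i ∂(gaussianVec n σ) = 0 := by
  have hInt : ∀ i, Integrable (fun z : Fin n → ℝ => a i * z i) (gaussianVec n σ) := fun i =>
    (integrable_eval (i := i) IsGaussian.integrable_id).const_mul (a i)
  refine ⟨integrable_finsetSum _ fun i _ => hInt i, ?_⟩
  rw [integral_finsetSum _ fun i _ => hInt i]
  refine Finset.sum_eq_zero fun i _ => ?_
  rw [integral_const_mul, gaussianVec, integral_eval]
  simp

lemma sum_mulVec_mul_mulVec {n : ℕ} {A : Matrix (Fin n) (Fin n) ℝ}
    (hA : A * A = A) (hsymm : A.IsSymm) (u z : Fin n → ℝ) :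
    ∑ i, A.mulVec u i * A.mulVec z i = ∑ i, u i * A.mulVec z i := by
  change A.mulVec u ⬝ᵥ A.mulVec z = u ⬝ᵥ A.mulVec z
  rw [← Matrix.vecMul_transpose, hsymm.eq, ← Matrix.dotProduct_mulVec, Matrix.mulVec_mulVec, hA]

/-- An orthogonal projector splits the loss into squared bias and noise. -/
lemma sum_sq_mulVec_add_sub {n : ℕ} {A : Matrix (Fin n) (Fin n) ℝ}
    (hA : A * A = A) (hsymm : A.IsSymm) (θ z : Fin n → ℝ) :
    ∑ i, (A.mulVec (θ + z) i - θ i) ^ 2 =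
      ∑ i, (θ i - A.mulVec θ i) ^ 2 + ∑ i, (A.mulVec z i) ^ 2 := by
  have key : ∑ i, (A.mulVec (θ + z) i - θ i) ^ 2 =
      ∑ i, (θ i - A.mulVec θ i) ^ 2 + ∑ i, (A.mulVec z i) ^ 2 +
        2 * (∑ i, A.mulVec θ i * A.mulVec z i - ∑ i, θ i * A.mulVec z i) := by
    rw [← Finset.sum_sub_distrib, Finset.mul_sum, ← Finset.sum_add_distrib,
      ← Finset.sum_add_distrib]
    refine Finset.sum_congr rfl fun i _ => ?_
    rw [Matrix.mulVec_add, Pi.add_apply]; ring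
  rw [key, sum_mulVec_mul_mulVec hA hsymm]; ring

/-- Expansion of the residual sum of squares of an orthogonal projector. -/
lemma sum_sq_add_sub_mulVec {n : ℕ} {A : Matrix (Fin n) (Fin n) ℝ}
    (hA : A * A = A) (hsymm : A.IsSymm) (θ z : Fin n → ℝ) :
    ∑ i, ((θ + z) i - A.mulVec (θ + z) i) ^ 2 =
      ∑ i, (θ i - A.mulVec θ i) ^ 2 + 2 * ∑ i, (θ i - A.mulVec θ i) * z i
        + ∑ i, z i ^ 2 - ∑ i, (A.mulVec z i) ^ 2 := by
  have key : ∑ i, ((θ + z) i - A.mulVec (θ + z) i) ^ 2 =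
      ∑ i, (θ i - A.mulVec θ i) ^ 2 + 2 * ∑ i, (θ i - A.mulVec θ i) * z i
        + ∑ i, z i ^ 2 - ∑ i, (A.mulVec z i) ^ 2
        + 2 * (∑ i, A.mulVec θ i * A.mulVec z i - ∑ i, θ i * A.mulVec z i)
        + 2 * (∑ i, A.mulVec z i * A.mulVec z i - ∑ i, z i * A.mulVec z i) := by
    simp only [← Finset.sum_sub_distrib, Finset.mul_sum, ← Finset.sum_add_distrib]
    refine Finset.sum_congr rfl fun i _ => ?_
    rw [Matrix.mulVec_add, Pi.add_apply, Pi.add_apply]; ring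
  rw [key, sum_mulVec_mul_mulVec hA hsymm θ, sum_mulVec_mul_mulVec hA hsymm z]; ring

instance isProbabilityMeasure_gaussianVec (n : ℕ) (σ : ℝ) :
    IsProbabilityMeasure (gaussianVec n σ) := by
  unfold gaussianVec; infer_instance

/-- Each member of a finite family is bounded by its log-cardinality plus an exponential average. -/
lemma le_log_card_add_average_exp {S : Type*} [Fintype S] [Nonempty S] (X : S → ℝ) (s : S) :
    X s ≤ Real.log (Fintype.card S) - 1 + (∑ r, Real.exp (X r)) / Fintype.card S := by
  have hN : (0 : ℝ) < Fintype.card S := by exact_mod_cast Fintype.card_pos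
  have h1 := Real.add_one_le_exp (X s - Real.log (Fintype.card S))
  rw [Real.exp_sub, Real.exp_log hN] at h1
  have h2 : Real.exp (X s) ≤ ∑ r, Real.exp (X r) :=
    Finset.single_le_sum (f := fun r => Real.exp (X r)) (fun r _ => (Real.exp_pos _).le)
      (Finset.mem_univ s)
  have h3 := div_le_div_of_nonneg_right h2 hN.le
  linarith

/-- Maximal inequality: a finite family whose exponential moments are at most one is dominated by
an integrable function with integral at most the log-cardinality. -/
lemma exists_integrable_bound_of_integral_exp_le_one {Ω S : Type*} [MeasurableSpace Ω]
    {μ : Measure Ω} [IsProbabilityMeasure μ] [Fintype S] [Nonempty S] {X : S → Ω → ℝ}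
    (hInt : ∀ s, Integrable (fun ω => Real.exp (X s ω)) μ)
    (hle : ∀ s, ∫ ω, Real.exp (X s ω) ∂μ ≤ 1) :
    ∃ M : Ω → ℝ, Integrable M μ ∧ ∫ ω, M ω ∂μ ≤ Real.log (Fintype.card S) ∧
      ∀ s ω, X s ω ≤ M ω := by
  have hN : (0 : ℝ) < Fintype.card S := by exact_mod_cast Fintype.card_pos
  have hsum : Integrable (fun ω => (∑ r, Real.exp (X r ω)) / Fintype.card S) μ :=
    (integrable_finsetSum _ fun r _ => hInt r).div_const _
  refine ⟨fun ω => Real.log (Fintype.card S) - 1 + (∑ r, Real.exp (X r ω)) / Fintype.card S,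
    (integrable_const _).add hsum, ?_, fun s ω => le_log_card_add_average_exp (X · ω) s⟩
  rw [integral_add (integrable_const _) hsum, integral_div,
    integral_finsetSum _ fun r _ => hInt r]
  have h : (∑ r, ∫ ω, Real.exp (X r ω) ∂μ) / Fintype.card S ≤ 1 := by
    rw [div_le_one hN]
    exact (Finset.sum_le_sum fun r _ => hle r).trans (by simp)
  simp only [integral_const, probReal_univ, one_smul]
  linarith

/-- The oracle inequality for small `η`, relative to an arbitrary competitor `s₀`. -/
lemma risk_le_of_SURE_minimizer {n : ℕ} {σ : ℝ} (hσ : 0 < σ) (θ₀ : Fin n → ℝ)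
    {S : Type} [Fintype S] [Nonempty S] {H : S → Matrix (Fin n) (Fin n) ℝ}
    (hproj : ∀ s, H s * H s = H s) (hsymm : ∀ s, (H s).IsSymm) {sh : (Fin n → ℝ) → S}
    (s₀ : S) (hmin : ∀ y, SUREf σ H (sh y) y ≤ SUREf σ H s₀ y) {η : ℝ} (hη : 0 < η)
    (hη' : η ≤ 1 / 2) :
    (∫ z, (∑ i, ((H (sh (θ₀ + z))).mulVec (θ₀ + z) i - θ₀ i) ^ 2) ∂(gaussianVec n σ))
      ≤ (1 + 2 * η) * riskP σ θ₀ H s₀ + 28 * σ ^ 2 * Real.log (Fintype.card S) / η := by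
  set L := Real.log (Fintype.card S)
  have hL : 0 ≤ L := Real.log_natCast_nonneg _
  set μ := gaussianVec n σ
  let bias : S → ℝ := fun s => ∑ i, (θ₀ i - (H s).mulVec θ₀ i) ^ 2
  let cross : S → (Fin n → ℝ) → ℝ := fun s z => ∑ i, (θ₀ i - (H s).mulVec θ₀ i) * z i
  let noise : S → (Fin n → ℝ) → ℝ := fun s z => ∑ i, ((H s).mulVec z i) ^ 2
  obtain ⟨A, hAint, hAL, hA⟩ := exists_integrable_bound_of_integral_exp_le_one (μ := μ)
    (X := fun s z => η / (2 * σ ^ 2) * (-2 * cross s z - η * bias s))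
    (fun s => by
      have h := (exp_dotProduct_gaussianVec σ
        (fun i => -(η / σ ^ 2) * (θ₀ i - (H s).mulVec θ₀ i))).1.mul_const
          (Real.exp (-(η ^ 2 / (2 * σ ^ 2) * bias s)))
      refine h.congr (Filter.Eventually.of_forall fun z => ?_)
      simp only [← Real.exp_add, cross, mul_assoc, ← Finset.mul_sum]
      congr 1
      field_simp
      ring)
    (fun s => by
      have h := (exp_dotProduct_gaussianVec σ
        (fun i => -(η / σ ^ 2) * (θ₀ i - (H s).mulVec θ₀ i))).2
      have hrw : ∀ z, Real.exp (η / (2 * σ ^ 2) * (-2 * cross s z - η * bias s)) =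
          Real.exp (∑ i, -(η / σ ^ 2) * (θ₀ i - (H s).mulVec θ₀ i) * z i) *
            Real.exp (-(η ^ 2 / (2 * σ ^ 2) * bias s)) := by
        intro z
        simp only [← Real.exp_add, cross, mul_assoc, ← Finset.mul_sum]
        congr 1
        field_simp
        ring
      simp_rw [hrw]
      rw [integral_mul_const, h, ← Real.exp_add]
      simp only [mul_pow, ← Finset.mul_sum]
      refine (congrArg Real.exp ?_).trans_le Real.exp_zero.le
      simp only [bias]
      field_simp
      ring)
  obtain ⟨B, hBint, hBL, hB⟩ := exists_integrable_bound_of_integral_exp_le_one (μ := μ)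
    (X := fun s z => η / (16 * σ ^ 2) *
      (2 * (noise s z - σ ^ 2 * (H s).trace) - η * (σ ^ 2 * (H s).trace)))
    (fun s => by
      have h := (exp_sum_sq_mulVec_gaussianVec hσ (hproj s) (hsymm s)
        (t := η / 8) (by linarith)).1.mul_const
          (Real.exp (-((η / 8 + η ^ 2 / 16) * (H s).trace)))
      refine h.congr (Filter.Eventually.of_forall fun z => ?_)
      simp only [← Real.exp_add, noise]
      congr 1
      field_simp
      ring)
    (fun s => by
      have h := (exp_sum_sq_mulVec_gaussianVec hσ (hproj s) (hsymm s)
        (t := η / 8) (by linarith)).2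
      have hrw : ∀ z, Real.exp (η / (16 * σ ^ 2) *
            (2 * (noise s z - σ ^ 2 * (H s).trace) - η * (σ ^ 2 * (H s).trace))) =
          Real.exp (η / 8 / σ ^ 2 * noise s z) *
            Real.exp (-((η / 8 + η ^ 2 / 16) * (H s).trace)) := by
        intro z
        rw [← Real.exp_add]
        congr 1
        field_simp
        ring
      simp_rw [hrw]
      rw [integral_mul_const]
      refine (mul_le_mul_of_nonneg_right h (Real.exp_pos _).le).trans ?_
      rw [← Real.exp_add]
      refine (congrArg Real.exp ?_).trans_le Real.exp_zero.le
      ring)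
  obtain ⟨hGint, hG⟩ := dotProduct_gaussianVec σ (fun i => θ₀ i - (H s₀).mulVec θ₀ i)
  obtain ⟨hWint, hW⟩ := sum_sq_mulVec_gaussianVec σ (hproj s₀) (hsymm s₀)
  have htr : ∀ s, 0 ≤ σ ^ 2 * (H s).trace := fun s =>
    (sum_sq_mulVec_gaussianVec σ (hproj s) (hsymm s)).2 ▸
      integral_nonneg fun z => Finset.sum_nonneg fun i _ => sq_nonneg _
  have hk : 0 ≤ η / (1 - η) := div_nonneg hη.le (by linarith)
  have hk2 : η / (1 - η) ≤ 2 * η := by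
    rw [div_le_iff₀ (by linarith)]; nlinarith
  set k := η / (1 - η) with hkdef
  have hkη : k * (1 - η) = η := div_mul_cancel₀ _ (by linarith)
  set R := riskP σ θ₀ H s₀ with hR
  set a := 2 * σ ^ 2 / η with ha
  set b := 16 * σ ^ 2 / η with hb
  have hapos : 0 < a := by positivity
  have hbpos : 0 < b := by positivity
  -- The centred noise and cross terms of the competitor integrate to zero.
  let D : (Fin n → ℝ) → ℝ := fun z => 2 * cross s₀ z - (noise s₀ z - σ ^ 2 * (H s₀).trace)
  have hWcent : Integrable (fun z => noise s₀ z - σ ^ 2 * (H s₀).trace) μ :=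
    hWint.sub (integrable_const _)
  have hDint : Integrable D μ := (hGint.const_mul 2).sub hWcent
  have hD : ∫ z, D z ∂μ = 0 := by
    rw [integral_sub (hGint.const_mul 2) hWcent, integral_sub hWint (integrable_const _),
      integral_const_mul, hG, hW]
    simp
  have hpoint : ∀ z, ∑ i, ((H (sh (θ₀ + z))).mulVec (θ₀ + z) i - θ₀ i) ^ 2 ≤
      (1 + k) * (R + D z) + ((1 + k) * a * A z + (1 + k / 2) * b * B z) := by
    intro z
    have hm := hmin (θ₀ + z)
    set s := sh (θ₀ + z)
    rw [SUREf, SUREf, sum_sq_add_sub_mulVec (hproj _) (hsymm _),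
      sum_sq_add_sub_mulVec (hproj _) (hsymm _)] at hm
    rw [sum_sq_mulVec_add_sub (hproj _) (hsymm _)]
    change bias s + noise s z ≤ _
    change bias s + 2 * cross s z + ∑ i, z i ^ 2 - noise s z + 2 * σ ^ 2 * (H s).trace ≤
      bias s₀ + 2 * cross s₀ z + ∑ i, z i ^ 2 - noise s₀ z + 2 * σ ^ 2 * (H s₀).trace at hm
    have hRdef : R = bias s₀ + σ ^ 2 * (H s₀).trace := rfl
    have hDz : D z = 2 * cross s₀ z - (noise s₀ z - σ ^ 2 * (H s₀).trace) := rfl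
    have h1 : -2 * cross s z - η * bias s ≤ a * A z := by
      have := mul_le_mul_of_nonneg_left (hA s z) hapos.le
      refine le_trans (le_of_eq ?_) this
      rw [ha]; field_simp
    have h2 : 2 * (noise s z - σ ^ 2 * (H s).trace) - η * (σ ^ 2 * (H s).trace) ≤ b * B z := by
      have := mul_le_mul_of_nonneg_left (hB s z) hbpos.le
      refine le_trans (le_of_eq ?_) this
      rw [hb]; field_simp
    have h3 : (1 - η) * (bias s + σ ^ 2 * (H s).trace) ≤ R + D z + a * A z + b * B z / 2 := by
      linarith [mul_nonneg hη.le (htr s)]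
    have h4 := mul_le_mul_of_nonneg_left h3 hk
    rw [← mul_assoc, hkη] at h4
    linarith
  have hInt1 : Integrable (fun z => (1 + k) * (R + D z)) μ :=
    ((integrable_const R).add hDint).const_mul _
  have hInt2 : Integrable (fun z => (1 + k) * a * A z) μ := hAint.const_mul _
  have hInt3 : Integrable (fun z => (1 + k / 2) * b * B z) μ := hBint.const_mul _
  have hInt23 : Integrable (fun z => (1 + k) * a * A z + (1 + k / 2) * b * B z) μ :=
    hInt2.add hInt3
  calc _ ≤ ∫ z, ((1 + k) * (R + D z) + ((1 + k) * a * A z + (1 + k / 2) * b * B z)) ∂μ :=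
        integral_mono_of_nonneg
          (Filter.Eventually.of_forall fun z => Finset.sum_nonneg fun i _ => sq_nonneg _)
          (hInt1.add hInt23) (Filter.Eventually.of_forall hpoint)
    _ = (1 + k) * R + ((1 + k) * a * ∫ z, A z ∂μ + (1 + k / 2) * b * ∫ z, B z ∂μ) := by
        rw [integral_add hInt1 hInt23, integral_add hInt2 hInt3, integral_const_mul,
          integral_const_mul, integral_const_mul, integral_add (integrable_const R) hDint, hD]
        simp
    _ ≤ (1 + 2 * η) * R + (2 * a * L + 3 / 2 * b * L) := by
        have hR0 : 0 ≤ R := add_nonneg (Finset.sum_nonneg fun i _ => sq_nonneg _) (htr s₀)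
        refine add_le_add (by gcongr) (add_le_add ?_ ?_)
        · exact (mul_le_mul_of_nonneg_left hAL (by positivity)).trans (by gcongr; linarith)
        · exact (mul_le_mul_of_nonneg_left hBL (by positivity)).trans (by gcongr; linarith)
    _ = _ := by
        rw [ha, hb]; ring

/-- almost-oracle inequality: there is a universal `C` such that
for SURE-tuned projection estimators, if `min_s R(s) ≥ σ² log|S|` and
`min_s R(s) ≥ σ²`, then for all `η > 0`,
`Risk(θ̂_{sh}) ≤ (1 + Cη) min_s R(s) + C σ² log|S| / η`. -/
theorem oracle_inequality_SURE_tuned_projection :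
    ∃ C : ℝ, 0 < C ∧
      ∀ (n : ℕ) (σ : ℝ), 0 < σ →
      ∀ (θ₀ : Fin n → ℝ)
        (S : Type) [Fintype S] [Nonempty S]
        [MeasurableSpace S] [MeasurableSingletonClass S]
        (H : S → Matrix (Fin n) (Fin n) ℝ),
        (∀ s, H s * H s = H s) → (∀ s, (H s).IsSymm) →
        ∀ (sh : (Fin n → ℝ) → S), Measurable sh →
        (∀ y, SUREf σ H (sh y) y = ⨅ s, SUREf σ H s y) →
        σ ^ 2 * Real.log (Fintype.card S) ≤ (⨅ s, riskP σ θ₀ H s) →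
        σ ^ 2 ≤ (⨅ s, riskP σ θ₀ H s) →
        ∀ η : ℝ, 0 < η →
        (∫ z, (∑ i, ((H (sh (θ₀ + z))).mulVec (θ₀ + z) i - θ₀ i) ^ 2)
            ∂(gaussianVec n σ))
          ≤ (1 + C * η) * (⨅ s, riskP σ θ₀ H s)
            + C * σ ^ 2 * Real.log (Fintype.card S) / η := by
  refine ⟨114, by norm_num, ?_⟩
  intro n σ hσ θ₀ S _ _ _ _ H hproj hsymm sh _ hmin hlog _ η hη
  obtain ⟨s₀, hs₀⟩ := exists_eq_ciInf_of_finite (f := fun s => riskP σ θ₀ H s)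
  rw [← hs₀] at hlog ⊢
  have hL : 0 ≤ Real.log (Fintype.card S) := Real.log_natCast_nonneg _
  have hmin' : ∀ y, SUREf σ H (sh y) y ≤ SUREf σ H s₀ y := fun y =>
    (hmin y).trans_le (ciInf_le (Set.finite_range _).bddBelow s₀)
  have hσL : 0 ≤ σ ^ 2 * Real.log (Fintype.card S) := by positivity
  have hR : 0 ≤ riskP σ θ₀ H s₀ := hσL.trans hlog
  rcases le_total η (1 / 2) with h | h
  · refine (risk_le_of_SURE_minimizer hσ θ₀ hproj hsymm s₀ hmin' hη h).trans ?_
    gcongr <;> norm_num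
  · refine (risk_le_of_SURE_minimizer hσ θ₀ hproj hsymm s₀ hmin'
      (η := 1 / 2) (by norm_num) le_rfl).trans ?_
    have h1 : 0 ≤ 114 * σ ^ 2 * Real.log (Fintype.card S) / η := by positivity
    have h2 := mul_le_mul_of_nonneg_right h hR
    linarith
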